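/- arXiv:1205.5200 — 2 statements merged into one kernel-verified Lean document; each statement's English description precedes it below -/
import Mathlib

section
/- The root subsystem Δ(Π_s) = Δ ∩ ℤΠ_s generated by the short simple roots is an irreducible root system; equivalently, Π_s is a connected subset of the Dynkin diagram of Δ, so that the subalgebra 𝔤(Π_s) is a simple Lie algebra. -/
open scoped RealInnerProductSpace

/-- The orthogonal reflection of a Euclidean space in the hyperplane orthogonal to `α`
(for `α ≠ 0` this is the usual reflection `x ↦ x - 2(x|α)/(α|α) α`). -/
noncomputable def rrefl {E : Type} [NormedAddCommGroup E] [InnerProductSpace ℝ E]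
    [FiniteDimensional ℝ E] (α : E) : E ≃ₗᵢ[ℝ] E :=
  Submodule.reflection ((ℝ ∙ α)ᗮ)

/-- The group generated by the reflections `r_α` for `α ∈ S`. -/
noncomputable def weylOf {E : Type} [NormedAddCommGroup E] [InnerProductSpace ℝ E]
    [FiniteDimensional ℝ E] (S : Set E) : Subgroup (E ≃ₗᵢ[ℝ] E) :=
  Subgroup.closure (rrefl '' S)

lemma rrefl_eq {E : Type} [NormedAddCommGroup E] [InnerProductSpace ℝ E]
    [FiniteDimensional ℝ E] (α β : E) :
    rrefl α β = β - (2 * ⟪β, α⟫ / ⟪α, α⟫) • α := by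
  unfold rrefl
  rw [Submodule.reflection_orthogonal_apply, Submodule.reflection_singleton_apply]
  rw [real_inner_comm, real_inner_self_eq_norm_sq]
  simp only [RCLike.ofReal_real_eq_id, id_eq, smul_smul, neg_sub, two_smul, ← add_smul]
  congr 2
  ring

lemma rrefl_rrefl {E : Type} [NormedAddCommGroup E] [InnerProductSpace ℝ E]
    [FiniteDimensional ℝ E] (α β : E) : rrefl α (rrefl α β) = β := by
  unfold rrefl
  exact Submodule.reflection_reflection _ _

/-- Induction: a reflection-stable property true on simple roots is true on positive roots. -/
lemma pos_induct {E : Type} [NormedAddCommGroup E] [InnerProductSpace ℝ E]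
    [FiniteDimensional ℝ E] (Δ Δp Φ : Set E) [Fintype Φ] (b : Module.Basis Φ ℝ E)
    (hb : ∀ i, b i = (i : E)) (h0 : (0 : E) ∉ Δ)
    (hrefl : ∀ α ∈ Δ, ∀ β ∈ Δ, rrefl α β ∈ Δ)
    (hcrys : ∀ α ∈ Δ, ∀ β ∈ Δ, ∃ n : ℤ, 2 * ⟪β, α⟫ / ⟪α, α⟫ = (n : ℝ))
    (hred : ∀ α ∈ Δ, ∀ t : ℝ, t • α ∈ Δ → t = 1 ∨ t = -1)
    (hΔpΔ : Δp ⊆ Δ) (hpm : ∀ α ∈ Δ, α ∈ Δp ∨ -α ∈ Δp) (hΦp : Φ ⊆ Δp)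
    (hnat : ∀ γ ∈ Δp, ∀ i, 0 ≤ b.repr γ i)
    (T : E → Prop) (hT : ∀ α ∈ Φ, T α) (hTr : ∀ α ∈ Φ, ∀ γ, T γ → T (rrefl α γ)) :
    ∀ γ ∈ Δp, T γ := by
  have key : ∀ n : ℕ, ∀ γ ∈ Δp, ∑ i, b.repr γ i < n → T γ := by
    intro n
    induction n with
    | zero =>
      intro γ hγ h
      have : 0 ≤ ∑ i, b.repr γ i := Finset.sum_nonneg fun i _ => hnat γ hγ i
      simp at h
      linarith
    | succ n ih =>
      intro γ hγ h
      by_cases hγΦ : γ ∈ Φ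
      · exact hT _ hγΦ
      have hγ0 : γ ≠ 0 := fun h => h0 (h ▸ hΔpΔ hγ)
      have hpos : 0 < ⟪γ, γ⟫ := real_inner_self_pos.2 hγ0
      have hex : ∃ i, 0 < b.repr γ i * ⟪γ, (i : E)⟫ := by
        by_contra! hcon
        have : ⟪γ, γ⟫ = ∑ i, b.repr γ i * ⟪γ, (i : E)⟫ := by
          conv_lhs => rw [← b.sum_repr γ]
          conv_lhs => rw [b.sum_repr γ, ← b.sum_repr γ, inner_sum]
          simp only [inner_smul_right, hb]
          rw [show (∑ x : Φ, (b.repr γ) x • (x : E)) = γ by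
            conv_rhs => rw [← b.sum_repr γ]
            simp [hb]]
        have h2 := Finset.sum_nonpos (s := Finset.univ) fun i _ => hcon i
        linarith
      obtain ⟨i, hi⟩ := hex
      have hci : 0 ≤ b.repr γ i := hnat γ hγ i
      have hin : 0 < ⟪γ, (i : E)⟫ := by
        by_contra! hc
        nlinarith [mul_nonpos_of_nonneg_of_nonpos hci hc]
      have hiΔ : (i : E) ∈ Δ := hΔpΔ (hΦp i.2)
      have hi0 : (i : E) ≠ 0 := fun h => h0 (h ▸ hiΔ)
      have hii : 0 < ⟪(i : E), (i : E)⟫ := real_inner_self_pos.2 hi0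
      obtain ⟨k, hk⟩ := hcrys _ hiΔ _ (hΔpΔ hγ)
      have hkpos : (0 : ℝ) < k := by rw [← hk]; positivity
      have hk1 : (1 : ℝ) ≤ k := by
        have : 0 < k := by exact_mod_cast hkpos
        exact_mod_cast this
      have hr : rrefl (i : E) γ = γ - (k : ℝ) • (i : E) := by rw [rrefl_eq, hk]
      have hrep : b.repr (rrefl (i : E) γ) = b.repr γ - (k : ℝ) • Finsupp.single i 1 := by
        rw [hr, ← hb i]; simp
      have hmem := hrefl _ hiΔ _ (hΔpΔ hγ)
      have hp : rrefl (i : E) γ ∈ Δp := by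
        rcases hpm _ hmem with h1 | h1
        · exact h1
        exfalso
        have hz : ∀ j, j ≠ i → b.repr γ j = 0 := by
          intro j hj
          have h3 := hnat _ h1 j
          rw [map_neg, hrep] at h3
          have h4 := hnat _ hγ j
          simp [Finsupp.single_apply, hj.symm] at h3
          linarith
        have hγi : γ = b.repr γ i • (i : E) := by
          conv_lhs => rw [← b.sum_repr γ]
          rw [Finset.sum_eq_single i, hb]
          · intro j _ hj; rw [hz j hj, zero_smul]
          · simp
        rcases hred _ hiΔ (b.repr γ i) (hγi ▸ hΔpΔ hγ) with h5 | h5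
        · rw [h5, one_smul] at hγi
          exact hγΦ (hγi ▸ i.2)
        · linarith
      have := ih _ hp (by
        rw [hrep]
        simp [Finset.sum_sub_distrib, Finsupp.single_apply]
        push_cast at h
        linarith)
      rw [← rrefl_rrefl (i : E) γ]
      exact hTr _ i.2 _ this
  intro γ hγ
  obtain ⟨n, hn⟩ := exists_nat_gt (∑ i, b.repr γ i)
  exact key n γ hγ hn

lemma span_orth {E : Type} [NormedAddCommGroup E] [InnerProductSpace ℝ E]
    (P : Set E) (x : E) (h : ∀ p ∈ P, ⟪p, x⟫ = 0) (y : E) (hy : y ∈ Submodule.span ℝ P) :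
    ⟪y, x⟫ = 0 := by
  induction hy using Submodule.span_induction with
  | mem y hy => exact h y hy
  | zero => simp
  | add a b _ _ ha hb => rw [inner_add_left, ha, hb, add_zero]
  | smul c a _ ha => rw [real_inner_smul_left, ha, mul_zero]

lemma rrefl_span {E : Type} [NormedAddCommGroup E] [InnerProductSpace ℝ E]
    [FiniteDimensional ℝ E] (P Q : Set E) (horth : ∀ a ∈ P, ∀ b ∈ Q, ⟪a, b⟫ = 0)
    (α : E) (hα : α ∈ P ∪ Q) (γ : E) (hγ : γ ∈ Submodule.span ℝ P) :
    rrefl α γ ∈ Submodule.span ℝ P := by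
  rw [rrefl_eq]
  rcases hα with h | h
  · exact Submodule.sub_mem _ hγ (Submodule.smul_mem _ _ (Submodule.subset_span h))
  · rw [span_orth P α (fun p hp => horth p hp α h) γ hγ]
    simpa using hγ

/-- long-short pair inequality -/
lemma long_pair {E : Type} [NormedAddCommGroup E] [InnerProductSpace ℝ E]
    (a l : E) (hl : 0 < ⟪l, l⟫) (h : ∃ n : ℤ, 2 * ⟪a, l⟫ / ⟪l, l⟫ = (n : ℝ))
    (hle : ⟪a, l⟫ ≤ 0) (hne : ⟪a, l⟫ ≠ 0) : 2 * ⟪a, l⟫ ≤ - ⟪l, l⟫ := by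
  obtain ⟨n, hn⟩ := h
  have hlt : ⟪a, l⟫ < 0 := lt_of_le_of_ne hle hne
  rw [div_eq_iff hl.ne'] at hn
  have : n < 0 := by
    by_contra! hc
    have : (0 : ℝ) ≤ n := by exact_mod_cast hc
    nlinarith [mul_nonneg this hl.le]
  have : n ≤ -1 := by omega
  have : (n : ℝ) ≤ -1 := by exact_mod_cast this
  nlinarith

lemma norm_ratio {E : Type} [NormedAddCommGroup E] [InnerProductSpace ℝ E]
    (a l : E) (ha : 0 < ⟪a, a⟫) (hal : ⟪a, a⟫ < ⟪l, l⟫)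
    (h : ∃ n : ℤ, 2 * ⟪a, l⟫ / ⟪l, l⟫ = (n : ℝ))
    (h' : ∃ n : ℤ, 2 * ⟪l, a⟫ / ⟪a, a⟫ = (n : ℝ))
    (hle : ⟪a, l⟫ ≤ 0) (hne : ⟪a, l⟫ ≠ 0) : 2 * ⟪a, a⟫ ≤ ⟪l, l⟫ := by
  have h1 := long_pair a l (ha.trans hal) h hle hne
  obtain ⟨n, hn⟩ := h'
  rw [div_eq_iff ha.ne', real_inner_comm] at hn
  have h2 : (n : ℝ) < -1 := by
    by_contra! hc
    nlinarith
  have h3 : n < -1 := by exact_mod_cast h2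
  have h4 : n ≤ -2 := by omega
  -- Cauchy-Schwarz
  have hcs := real_inner_mul_inner_self_le a l
  obtain ⟨m, hm⟩ := h
  have hl := ha.trans hal
  rw [div_eq_iff hl.ne'] at hm
  have hm1 : (-2 : ℝ) < m := by
    by_contra! hc
    have : ⟪a, l⟫ ≤ - ⟪l, l⟫ := by nlinarith
    nlinarith
  have hm2 : (m : ℝ) < 0 := by
    by_contra! hc
    nlinarith
  have hm3 : m = -1 := by
    have : (-2 : ℤ) < m := by exact_mod_cast hm1
    have : m < 0 := by exact_mod_cast hm2
    omega
  have : (n : ℝ) ≤ -2 := by exact_mod_cast h4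
  rw [hm3] at hm
  push_cast at hm
  nlinarith

/-- The root subsystem `Δ(Πs) = Δ ∩ ℤΠs` generated by the short simple
roots is an irreducible root system; equivalently, `Πs` is a connected subset of the Dynkin
diagram of `Δ`. -/
theorem statement16
    {E : Type} [NormedAddCommGroup E] [InnerProductSpace ℝ E] [FiniteDimensional ℝ E]
    (Δ Δs Δl Δp Φ Φs : Set E)
    -- `Δ` is a finite set of nonzero vectors spanning `E`
    (hfin : Δ.Finite) (h0 : (0 : E) ∉ Δ)
    (hspan : Submodule.span ℝ Δ = ⊤)
    -- stable under all root reflections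
    (hrefl : ∀ α ∈ Δ, ∀ β ∈ Δ, rrefl α β ∈ Δ)
    -- crystallographic
    (hcrys : ∀ α ∈ Δ, ∀ β ∈ Δ, ∃ n : ℤ, 2 * ⟪β, α⟫ / ⟪α, α⟫ = (n : ℝ))
    -- reduced
    (hred : ∀ α ∈ Δ, ∀ t : ℝ, t • α ∈ Δ → t = 1 ∨ t = -1)
    -- irreducible
    (hirr : ∀ A B : Set E, A ∪ B = Δ → (∀ a ∈ A, ∀ b ∈ B, ⟪a, b⟫ = 0) → A = ∅ ∨ B = ∅)
    -- two root lengths: `Δs` are the short roots, `Δl` the long ones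
    (ls ll : ℝ) (h0ls : 0 < ls) (hlsll : ls < ll)
    (hΔs : Δs = {α ∈ Δ | ‖α‖ = ls}) (hΔl : Δl = {α ∈ Δ | ‖α‖ = ll})
    (hcover : Δ = Δs ∪ Δl) (hsne : Δs.Nonempty) (hlne : Δl.Nonempty)
    -- `Δp` is a positive system: for each root exactly one of `±α` is positive
    (hΔpΔ : Δp ⊆ Δ) (hpm : ∀ α ∈ Δ, α ∈ Δp ↔ -α ∉ Δp)
    -- `Φ` is the corresponding set of simple roots, `Φs = Φ ∩ Δs` the short simple roots
    (hΦp : Φ ⊆ Δp)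
    (hΦind : LinearIndependent ℝ (fun a : Φ => (a : E)))
    (hΦdec : ∀ γ ∈ Δp, ∃ c : E →₀ ℕ, ↑c.support ⊆ Φ ∧ γ = c.sum fun α n => (n : ℝ) • α)
    (hΦs : Φs = Φ ∩ Δs)
 :
    Φs.Nonempty ∧
    (∀ A B : Set E,
      A ∪ B = {γ ∈ Δ | ∃ c : E →₀ ℤ, ↑c.support ⊆ Φs ∧ γ = c.sum fun α n => n • α} →
      (∀ a ∈ A, ∀ b ∈ B, ⟪a, b⟫ = 0) → A = ∅ ∨ B = ∅) ∧
    (∀ A B : Set E, A ∪ B = Φs → (∀ a ∈ A, ∀ b ∈ B, ⟪a, b⟫ = 0) →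
      A = ∅ ∨ B = ∅) := by
  classical
  have hmemΔ : ∀ γ ∈ Δ, γ ∈ Δp ∨ -γ ∈ Δp := by
    intro γ hγ
    by_cases h : γ ∈ Δp
    · exact Or.inl h
    · right
      by_contra h'
      exact h ((hpm γ hγ).2 h')
  have hΦΔ : Φ ⊆ Δ := hΦp.trans hΔpΔ
  have hΦfin : Φ.Finite := hfin.subset hΦΔ
  have : Fintype Φ := hΦfin.fintype
  have hspΦp : ∀ γ ∈ Δp, γ ∈ Submodule.span ℝ Φ := by
    intro γ hγ
    obtain ⟨c, hc, rfl⟩ := hΦdec γ hγ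
    exact Submodule.sum_mem _ fun i hi =>
      Submodule.smul_mem _ _ (Submodule.subset_span (hc hi))
  have hspΦ : Submodule.span ℝ Φ = ⊤ := by
    rw [eq_top_iff, ← hspan, Submodule.span_le]
    intro γ hγ
    rcases hmemΔ γ hγ with h | h
    · exact hspΦp γ h
    · have := hspΦp _ h
      simpa using Submodule.neg_mem _ this
  let b : Module.Basis Φ ℝ E := Module.Basis.mk hΦind (by simp [hspΦ])
  have hb : ∀ i, b i = (i : E) := fun i => by simp [b]
  have hnat : ∀ γ ∈ Δp, ∀ i, 0 ≤ b.repr γ i := by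
    intro γ hγ i
    obtain ⟨c, hc, rfl⟩ := hΦdec γ hγ
    rw [Finsupp.sum, map_sum, Finsupp.finsetSum_apply]
    refine Finset.sum_nonneg fun j hj => ?_
    have : b.repr j = Finsupp.single ⟨j, hc hj⟩ 1 := by
      rw [← b.repr_self, hb]
    rw [map_smul, this]
    simp only [Finsupp.smul_apply, Finsupp.single_apply, smul_eq_mul]
    split_ifs <;> simp
  have hpind := pos_induct Δ Δp Φ b hb h0 hrefl hcrys hred hΔpΔ hmemΔ hΦp hnat
  have hobt : ∀ α ∈ Φ, ∀ β ∈ Φ, α ≠ β → ⟪α, β⟫ ≤ 0 := by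
    intro α hα β hβ hne
    by_contra! hc
    have hr := hrefl α (hΦΔ hα) β (hΦΔ hβ)
    rw [rrefl_eq] at hr
    have hα0 : α ≠ 0 := fun h => h0 (h ▸ hΦΔ hα)
    have hk : 0 < 2 * ⟪β, α⟫ / ⟪α, α⟫ := by
      rw [real_inner_comm]
      have := real_inner_self_pos.2 hα0
      positivity
    set k := 2 * ⟪β, α⟫ / ⟪α, α⟫
    have h1 : b.repr α = Finsupp.single ⟨α, hα⟩ 1 := by rw [← b.repr_self, hb]
    have h2 : b.repr β = Finsupp.single ⟨β, hβ⟩ 1 := by rw [← b.repr_self, hb]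
    rcases hmemΔ _ hr with h | h
    · have := hnat _ h ⟨α, hα⟩
      rw [map_sub, map_smul, h1, h2] at this
      simp [Finsupp.single_apply, hne.symm] at this
      linarith
    · have := hnat _ h ⟨β, hβ⟩
      rw [map_neg, map_sub, map_smul, h1, h2] at this
      simp [Finsupp.single_apply, hne] at this
      linarith
  have hΦirr : ∀ P Q : Set E, P ∪ Q = Φ → (∀ a ∈ P, ∀ b ∈ Q, ⟪a, b⟫ = 0) →
      P = ∅ ∨ Q = ∅ := by
    intro P Q hPQ horth
    have horth' : ∀ a ∈ Q, ∀ b ∈ P, ⟪a, b⟫ = 0 := fun a ha b hb => by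
      rw [real_inner_comm]; exact horth b hb a ha
    have hT := hpind (fun γ => γ ∈ Submodule.span ℝ P ∨ γ ∈ Submodule.span ℝ Q)
      (by
        intro α hα
        rw [← hPQ] at hα
        exact hα.imp (fun h => Submodule.subset_span h) (fun h => Submodule.subset_span h))
      (by
        intro α hα γ hγ
        rw [← hPQ] at hα
        exact hγ.imp (rrefl_span P Q horth α hα γ) (rrefl_span Q P horth' α hα.symm γ))
    rcases hirr (Δ ∩ Submodule.span ℝ P) (Δ ∩ Submodule.span ℝ Q) (by
        rw [← Set.inter_union_distrib_left, Set.inter_eq_left]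
        intro γ hγ
        rcases hmemΔ γ hγ with h | h
        · exact hT γ h
        · have := hT _ h
          simpa using this) (by
        rintro x ⟨_, hx⟩ y ⟨_, hy⟩
        refine span_orth P y (fun p hp => ?_) x hx
        rw [real_inner_comm]
        exact span_orth Q p (fun q hq => horth' q hq p hp) y hy) with h | h
    · left
      rw [Set.eq_empty_iff_forall_notMem] at h ⊢
      exact fun x hx => h x ⟨hΦΔ (hPQ ▸ Or.inl hx), Submodule.subset_span hx⟩
    · right
      rw [Set.eq_empty_iff_forall_notMem] at h ⊢
      exact fun x hx => h x ⟨hΦΔ (hPQ ▸ Or.inr hx), Submodule.subset_span hx⟩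
  have hlen : ∀ γ ∈ Δ, ‖γ‖ = ls ∨ ‖γ‖ = ll := by
    intro γ hγ
    rw [hcover, hΔs, hΔl] at hγ
    exact hγ.imp (fun h => h.2) (fun h => h.2)
  have hΦs_mem : ∀ x, x ∈ Φs ↔ x ∈ Φ ∧ ‖x‖ = ls := by
    intro x
    rw [hΦs, hΔs]
    exact ⟨fun h => ⟨h.1, h.2.2⟩, fun h => ⟨h.1, hΦΔ h.1, h.2⟩⟩
  have hΦsΦ : Φs ⊆ Φ := fun x hx => ((hΦs_mem x).1 hx).1
  have hne : Φs.Nonempty := by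
    by_contra hemp
    rw [Set.not_nonempty_iff_eq_empty] at hemp
    have hT := hpind (fun γ => ‖γ‖ = ll)
      (by
        intro α hα
        rcases hlen α (hΦΔ hα) with h | h
        · have := (hΦs_mem α).2 ⟨hα, h⟩
          rw [hemp] at this
          exact this.elim
        · exact h)
      (by
        intro α _ γ hγ
        simpa using hγ)
    obtain ⟨s, hs⟩ := hsne
    rw [hΔs] at hs
    have : ‖s‖ = ll := by
      rcases hmemΔ s hs.1 with h | h
      · exact hT s h
      · simpa using hT _ h
    have := hs.2
    linarith
  have hconn : ∀ A B : Set E, A ∪ B = Φs → (∀ a ∈ A, ∀ b ∈ B, ⟪a, b⟫ = 0) →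
      A = ∅ ∨ B = ∅ := by
    intro A B hAB horth
    by_cases hA : A = ∅
    · exact Or.inl hA
    right
    have hAs : ∀ x ∈ A, x ∈ Φ ∧ ‖x‖ = ls := fun x hx => (hΦs_mem x).1 (hAB ▸ Or.inl hx)
    have hBs : ∀ x ∈ B, x ∈ Φ ∧ ‖x‖ = ls := fun x hx => (hΦs_mem x).1 (hAB ▸ Or.inr hx)
    -- long simple roots reachable from `A`
    let R : E → Prop := fun l => ∃ L : Finset E, (∀ x ∈ L, x ∈ Φ ∧ ‖x‖ = ll) ∧ l ∈ L ∧
      ⟪∑ x ∈ L, x, ∑ x ∈ L, x⟫ ≤ ll ^ 2 ∧ ∃ a ∈ A, ∃ x ∈ L, ⟪a, x⟫ ≠ 0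
    have hll : 0 < ll := h0ls.trans hlsll
    have hself : ∀ x : E, ∀ r : ℝ, ‖x‖ = r → ⟪x, x⟫ = r ^ 2 := fun x r h => by
      rw [real_inner_self_eq_norm_sq, h]
    have hneq : ∀ x y : E, ‖x‖ = ls → ‖y‖ = ll → x ≠ y := by
      rintro x y h1 h2 rfl
      linarith
    -- sum estimate
    have hsum : ∀ (L : Finset E) (y : E), y ∈ Φ → (∀ x ∈ L, x ∈ Φ ∧ ‖x‖ = ll) → y ∉ L →
        (∃ x ∈ L, ⟪y, x⟫ ≠ 0) → 2 * ⟪y, ∑ x ∈ L, x⟫ ≤ - ll ^ 2 := by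
      rintro L y hy hL hyL ⟨x, hx, hxy⟩
      have hyx : y ≠ x := fun h => hyL (h ▸ hx)
      have h1 : 2 * ⟪y, x⟫ ≤ - ⟪x, x⟫ := long_pair y x (by
        rw [hself x ll (hL x hx).2]; positivity)
        (hcrys x (hΦΔ (hL x hx).1) y (hΦΔ hy)) (hobt y hy x (hL x hx).1 hyx) hxy
      rw [hself x ll (hL x hx).2] at h1
      rw [inner_sum, ← Finset.add_sum_erase L _ hx]
      have h2 : ∑ z ∈ L.erase x, ⟪y, z⟫ ≤ 0 := by
        refine Finset.sum_nonpos fun z hz => ?_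
        have hzL := Finset.mem_of_mem_erase hz
        exact hobt y hy z (hL z hzL).1 (fun h => hyL (h ▸ hzL))
      linarith
    have := hΦirr (A ∪ {l ∈ Φ | ‖l‖ = ll ∧ R l}) (B ∪ {l ∈ Φ | ‖l‖ = ll ∧ ¬ R l}) (by
      ext x
      constructor
      · rintro ((h | h) | (h | h))
        · exact (hAs x h).1
        · exact h.1
        · exact (hBs x h).1
        · exact h.1
      · intro hx
        rcases hlen x (hΦΔ hx) with h | h
        · have : x ∈ A ∪ B := hAB ▸ (hΦs_mem x).2 ⟨hx, h⟩
          exact this.imp Or.inl Or.inl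
        · by_cases hR : R x
          · exact Or.inl (Or.inr ⟨hx, h, hR⟩)
          · exact Or.inr (Or.inr ⟨hx, h, hR⟩)) (by
      rintro p (hp | ⟨hpΦ, hpl, L, hL, hpL, hLn, a, ha, x, hx, hax⟩) q (hq | ⟨hqΦ, hql, hqR⟩)
      · exact horth p hp q hq
      · by_contra hpq
        refine hqR ⟨{q}, ?_, by simp, ?_, p, hp, q, by simp, hpq⟩
        · intro x hx
          rw [Finset.mem_singleton] at hx
          rw [hx]; exact ⟨hqΦ, hql⟩
        · rw [Finset.sum_singleton, hself q ll hql]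
      · by_contra hpq
        have haL : a ∉ L := fun h => hneq a a (hAs a ha).2 (hL a h).2 rfl
        have hqL : q ∉ L := fun h => hneq q q (hBs q hq).2 (hL q h).2 rfl
        have e1 := hsum L a (hAs a ha).1 hL haL ⟨x, hx, hax⟩
        have e2 := hsum L q (hBs q hq).1 hL hqL ⟨p, hpL, by rwa [real_inner_comm]⟩
        have e3 : 2 * ls ^ 2 ≤ ll ^ 2 := by
          have hxl := hL x hx
          have has := hAs a ha
          have := norm_ratio a x (by rw [hself a ls has.2]; positivity)
            (by
              rw [hself a ls has.2, hself x ll hxl.2]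
              nlinarith)
            (hcrys x (hΦΔ hxl.1) a (hΦΔ has.1)) (hcrys a (hΦΔ has.1) x (hΦΔ hxl.1))
            (hobt a has.1 x hxl.1 (hneq a x has.2 hxl.2)) hax
          rwa [hself a ls has.2, hself x ll hxl.2] at this
        have e4 := horth a ha q hq
        have haq : a ≠ q := by
          rintro rfl
          rw [hself a ls (hAs a ha).2] at e4
          have : 0 < ls ^ 2 := by positivity
          linarith
        set v := ∑ x ∈ L, x with hv
        have e5 : ⟪a + q + v, a + q + v⟫ ≤ 0 := by
          have : ⟪a + q + v, a + q + v⟫ = ⟪a, a⟫ + ⟪q, q⟫ + ⟪v, v⟫ + 2 * ⟪a, q⟫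
              + 2 * ⟪a, v⟫ + 2 * ⟪q, v⟫ := by
            simp only [inner_add_left, inner_add_right]
            rw [real_inner_comm a q, real_inner_comm a v, real_inner_comm q v]
            ring
          rw [this, hself a ls (hAs a ha).2, hself q ls (hBs q hq).2, e4]
          linarith
        have e6 : a + q + v = 0 := by
          rwa [real_inner_self_nonpos] at e5
        have e7 : 0 ≤ b.repr v ⟨a, (hAs a ha).1⟩ := by
          rw [hv, map_sum, Finsupp.finsetSum_apply]
          exact Finset.sum_nonneg fun z hz => hnat z (hΦp (hL z hz).1) _
        have e8 : 0 ≤ b.repr q ⟨a, (hAs a ha).1⟩ := hnat q (hΦp (hBs q hq).1) _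
        have e9 : b.repr a ⟨a, (hAs a ha).1⟩ = 1 := by
          have : b.repr a = Finsupp.single ⟨a, (hAs a ha).1⟩ 1 := by rw [← b.repr_self, hb]
          rw [this]; simp
        have e10 := congrArg (fun z => b.repr z ⟨a, (hAs a ha).1⟩) e6
        simp only [map_add, map_zero, Finsupp.add_apply, Finsupp.zero_apply] at e10
        linarith
      · by_contra hpq
        have hqL : q ∉ L := fun h => hqR ⟨L, hL, h, hLn, a, ha, x, hx, hax⟩
        have e2 := hsum L q hqΦ hL hqL ⟨p, hpL, by rwa [real_inner_comm]⟩
        refine hqR ⟨insert q L, ?_, by simp, ?_, a, ha, x, by simp [hx], hax⟩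
        · intro z hz
          rcases Finset.mem_insert.1 hz with rfl | h
          · exact ⟨hqΦ, hql⟩
          · exact hL z h
        · rw [Finset.sum_insert hqL]
          set v := ∑ x ∈ L, x
          have : ⟪q + v, q + v⟫ = ⟪q, q⟫ + ⟪v, v⟫ + 2 * ⟪q, v⟫ := by
            simp only [inner_add_left, inner_add_right]
            rw [real_inner_comm q v]
            ring
          rw [this, hself q ll hql]
          linarith)
    rcases this with h | h
    · exact absurd (Set.union_empty_iff.1 h).1 hA
    · exact (Set.union_empty_iff.1 h).1
  refine ⟨hne, ?_, hconn⟩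
  intro A B hAB horth
  set D := {γ ∈ Δ | ∃ c : E →₀ ℤ, ↑c.support ⊆ Φs ∧ γ = c.sum fun α n => n • α} with hD
  have hDspan : ∀ γ ∈ D, γ ∈ Submodule.span ℝ Φs := by
    rintro γ ⟨_, c, hc, rfl⟩
    exact Submodule.sum_mem _ fun i hi =>
      zsmul_mem (Submodule.subset_span (hc hi)) _
  have hΦsD : Φs ⊆ D := by
    intro x hx
    refine ⟨hΦΔ (hΦsΦ hx), Finsupp.single x 1, ?_, by simp⟩
    intro y hy
    have := Finsupp.support_single_subset hy
    rw [Finset.mem_singleton] at this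
    rwa [this]
  have hfinish : ∀ A B : Set E, A ⊆ D → (∀ a ∈ A, ∀ b ∈ B, ⟪a, b⟫ = 0) → Φs ⊆ B → A = ∅ := by
    intro A B hAD ho hB
    rw [Set.eq_empty_iff_forall_notMem]
    intro a ha
    have := span_orth Φs a (fun p hp => by rw [real_inner_comm]; exact ho a ha p (hB hp)) a
      (hDspan a (hAD ha))
    rw [inner_self_eq_zero] at this
    exact h0 (this ▸ (hAD ha).1)
  have hAD : A ⊆ D := hAB ▸ Set.subset_union_left
  have hBD : B ⊆ D := hAB ▸ Set.subset_union_right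
  rcases hconn (A ∩ Φs) (B ∩ Φs) (by
      rw [← Set.union_inter_distrib_right, hAB]
      exact Set.inter_eq_right.2 hΦsD) (fun a ha b hb => horth a ha.1 b hb.1) with h | h
  · left
    refine hfinish A B hAD horth fun x hx => ?_
    have : x ∈ A ∪ B := hAB ▸ hΦsD hx
    rcases this with h' | h'
    · exact (Set.eq_empty_iff_forall_notMem.1 h x ⟨h', hx⟩).elim
    · exact h'
  · right
    refine hfinish B A hBD (fun a ha b hb => by rw [real_inner_comm]; exact horth b hb a ha)
      fun x hx => ?_
    have : x ∈ A ∪ B := hAB ▸ hΦsD hx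
    rcases this with h' | h'
    · exact h'
    · exact (Set.eq_empty_iff_forall_notMem.1 h x ⟨h', hx⟩).elim
end

section
/- Every short root is conjugate under the long Weyl subgroup to a root of the subsystem generated by the short simple roots: for every γ ∈ Δ_s there exists w ∈ W_l with w(γ) ∈ Δ(Π_s). -/
open scoped RealInnerProductSpace

section helpers17
variable {E : Type} [NormedAddCommGroup E] [InnerProductSpace ℝ E] [FiniteDimensional ℝ E]

theorem rrefl_formula (α x : E) : rrefl α x = x - (2 * ⟪x, α⟫ / ⟪α, α⟫) • α := by
  rw [rrefl, Submodule.reflection_orthogonal_apply, Submodule.reflection_singleton_apply]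
  rw [real_inner_self_eq_norm_sq, real_inner_comm]
  simp only [RCLike.ofReal_real_eq_id, id, neg_sub]
  rw [← Nat.cast_smul_eq_nsmul ℝ, smul_smul, mul_div_assoc]
  norm_num

theorem rrefl_invol (α x : E) : rrefl α (rrefl α x) = x := by
  simp [rrefl]

theorem rrefl_self (α : E) (h : α ≠ 0) : rrefl α α = -α := by
  rw [rrefl_formula, mul_div_assoc, div_self (inner_self_ne_zero.2 h), mul_one, two_smul]
  abel

theorem rrefl_conj (g : E ≃ₗᵢ[ℝ] E) (β : E) : g * rrefl β * g⁻¹ = rrefl (g β) := by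
  ext x
  obtain ⟨y, rfl⟩ := g.surjective x
  have h : (g * rrefl β * g⁻¹) (g y) = g (rrefl β y) := by
    change g (rrefl β (g.symm (g y))) = _
    simp
  rw [h, rrefl_formula, rrefl_formula]
  simp [map_sub, map_smul]

theorem weylOf_conj (S : Set E) (g : E ≃ₗᵢ[ℝ] E) (hg : ∀ β ∈ S, g β ∈ S)
    (w : E ≃ₗᵢ[ℝ] E) (hw : w ∈ weylOf S) : g * w * g⁻¹ ∈ weylOf S := by
  unfold weylOf at hw
  induction hw using Subgroup.closure_induction with
  | mem x hx =>
    obtain ⟨β, hβ, rfl⟩ := hx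
    rw [rrefl_conj]
    exact Subgroup.subset_closure ⟨_, hg β hβ, rfl⟩
  | one => simpa using one_mem _
  | mul x y _ _ hx hy =>
    have := mul_mem hx hy
    convert this using 1
    group
  | inv x _ hx =>
    have := inv_mem hx
    convert this using 1
    group

theorem exists_functional (Φ : Set E) (hΦ : LinearIndependent ℝ (fun a : Φ => (a : E)))
    (g : E → ℝ) : ∃ f : E →ₗ[ℝ] ℝ, ∀ a ∈ Φ, f a = g a := by
  have hΦ' : LinearIndepOn ℝ id Φ := hΦ
  refine ⟨(Module.Basis.extend hΦ').constr ℝ (fun a => g a), fun a ha => ?_⟩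
  have hm : a ∈ hΦ'.extend (Set.subset_univ Φ) := hΦ'.subset_extend _ ha
  have := (Module.Basis.extend hΦ').constr_basis ℝ (fun a => g a) ⟨a, hm⟩
  simpa using this

end helpers17

/-- Every short root is conjugate under the long Weyl subgroup `W_l` to a
root of the subsystem `Δ(Πs) = Δ ∩ ℤΠs` generated by the short simple roots. -/
theorem statement17
    {E : Type} [NormedAddCommGroup E] [InnerProductSpace ℝ E] [FiniteDimensional ℝ E]
    (Δ Δs Δl Δp Φ Φs : Set E)
    -- `Δ` is a finite set of nonzero vectors spanning `E`
    (hfin : Δ.Finite) (h0 : (0 : E) ∉ Δ)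
    (hspan : Submodule.span ℝ Δ = ⊤)
    -- stable under all root reflections
    (hrefl : ∀ α ∈ Δ, ∀ β ∈ Δ, rrefl α β ∈ Δ)
    -- crystallographic
    (hcrys : ∀ α ∈ Δ, ∀ β ∈ Δ, ∃ n : ℤ, 2 * ⟪β, α⟫ / ⟪α, α⟫ = (n : ℝ))
    -- reduced
    (hred : ∀ α ∈ Δ, ∀ t : ℝ, t • α ∈ Δ → t = 1 ∨ t = -1)
    -- irreducible
    (hirr : ∀ A B : Set E, A ∪ B = Δ → (∀ a ∈ A, ∀ b ∈ B, ⟪a, b⟫ = 0) → A = ∅ ∨ B = ∅)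
    -- two root lengths: `Δs` are the short roots, `Δl` the long ones
    (ls ll : ℝ) (h0ls : 0 < ls) (hlsll : ls < ll)
    (hΔs : Δs = {α ∈ Δ | ‖α‖ = ls}) (hΔl : Δl = {α ∈ Δ | ‖α‖ = ll})
    (hcover : Δ = Δs ∪ Δl) (hsne : Δs.Nonempty) (hlne : Δl.Nonempty)
    -- `Δp` is a positive system: for each root exactly one of `±α` is positive
    (hΔpΔ : Δp ⊆ Δ) (hpm : ∀ α ∈ Δ, α ∈ Δp ↔ -α ∉ Δp)
    -- `Φ` is the corresponding set of simple roots, `Φs = Φ ∩ Δs` the short simple roots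
    (hΦp : Φ ⊆ Δp)
    (hΦind : LinearIndependent ℝ (fun a : Φ => (a : E)))
    (hΦdec : ∀ γ ∈ Δp, ∃ c : E →₀ ℕ, ↑c.support ⊆ Φ ∧ γ = c.sum fun α n => (n : ℝ) • α)
    (hΦs : Φs = Φ ∩ Δs)
 :
    ∀ γ ∈ Δs, ∃ w ∈ weylOf Δl,
      w γ ∈ {δ ∈ Δ | ∃ c : E →₀ ℤ, ↑c.support ⊆ Φs ∧ δ = c.sum fun α n => n • α} := by
  have hneg : ∀ α ∈ Δ, -α ∈ Δ := by
    intro α hα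
    rw [← rrefl_self α (fun h => h0 (h ▸ hα))]
    exact hrefl α hα α hα
  have hsmem : ∀ x, x ∈ Δs ↔ x ∈ Δ ∧ ‖x‖ = ls := fun x => by rw [hΔs]; rfl
  have hlmem : ∀ x, x ∈ Δl ↔ x ∈ Δ ∧ ‖x‖ = ll := fun x => by rw [hΔl]; rfl
  have hval : ∀ (f : E →ₗ[ℝ] ℝ) (c : E →₀ ℕ), f (c.sum fun α n => (n : ℝ) • α)
      = ∑ a ∈ c.support, (c a : ℝ) * f a := by
    intro f c
    simp [Finsupp.sum, map_sum]
  have hnn : ∀ f : E →ₗ[ℝ] ℝ, (∀ a ∈ Φ, 0 ≤ f a) → ∀ γ ∈ Δp, 0 ≤ f γ := by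
    intro f hf γ hγ
    obtain ⟨c, hc, rfl⟩ := hΦdec γ hγ
    rw [hval]
    exact Finset.sum_nonneg fun a ha => mul_nonneg (Nat.cast_nonneg _) (hf a (hc ha))
  obtain ⟨ht, hht⟩ := exists_functional Φ hΦind (fun _ => 1)
  have key : ∀ n : ℕ, ∀ γ ∈ Δp, γ ∈ Δs → ht γ < n → ∃ w ∈ weylOf Δl,
      w γ ∈ Δ ∧ w γ ∈ Submodule.span ℤ Φs := by
    intro n
    induction n with
    | zero =>
      intro γ hγ _ hlt
      have := hnn ht (fun a ha => by rw [hht a ha]; norm_num) γ hγ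
      rw [Nat.cast_zero] at hlt
      linarith
    | succ n ih =>
      intro γ hγ hγs hlt
      have hγΔ := hΔpΔ hγ
      obtain ⟨c, hc, hγc⟩ := hΦdec γ hγ
      have hex : ∃ α ∈ c.support, 0 < ⟪γ, α⟫ := by
        by_contra! hcon
        have h1 : (innerₛₗ ℝ γ) γ = ∑ a ∈ c.support, (c a : ℝ) * (innerₛₗ ℝ γ) a := by
          rw [← hval, ← hγc]
        have h2 : ∑ a ∈ c.support, (c a : ℝ) * (innerₛₗ ℝ γ) a ≤ 0 :=
          Finset.sum_nonpos fun a ha =>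
            mul_nonpos_of_nonneg_of_nonpos (Nat.cast_nonneg _) (hcon a ha)
        have h3 : 0 < ⟪γ, γ⟫ := real_inner_self_pos.2 (fun h => h0 (h ▸ hγΔ))
        rw [← h1] at h2
        exact absurd h2 (not_le.2 h3)
      obtain ⟨α, hαc, hαpos⟩ := hex
      have hαΦ : α ∈ Φ := hc hαc
      have hαΔ : α ∈ Δ := hΔpΔ (hΦp hαΦ)
      have hα0 : α ≠ 0 := fun h => h0 (h ▸ hαΔ)
      obtain ⟨k, hk⟩ := hcrys α hαΔ γ hγΔ
      have hkpos : (0 : ℝ) < k := by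
        rw [← hk]
        exact div_pos (by linarith) (real_inner_self_pos.2 hα0)
      have hk1 : (1 : ℝ) ≤ k := by
        have : (0 : ℤ) < k := by exact_mod_cast hkpos
        exact_mod_cast this
      have hr : rrefl α γ = γ - (k : ℝ) • α := by rw [rrefl_formula, hk]
      have hrΔ : rrefl α γ ∈ Δ := hrefl α hαΔ γ hγΔ
      have hrs : rrefl α γ ∈ Δs := by
        rw [hsmem]
        exact ⟨hrΔ, by rw [LinearIsometryEquiv.norm_map]; exact ((hsmem γ).1 hγs).2⟩
      by_cases hp : rrefl α γ ∈ Δp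
      · obtain ⟨w, hw, hwΔ, hwZ⟩ := ih (rrefl α γ) hp hrs (by
          rw [hr, map_sub, map_smul, hht α hαΦ, smul_eq_mul]
          push_cast at hlt
          linarith)
        by_cases hαl : α ∈ Δl
        · exact ⟨w * rrefl α, mul_mem hw (Subgroup.subset_closure ⟨α, hαl, rfl⟩), hwΔ, hwZ⟩
        · have hαs : α ∈ Δs := by
            rw [hcover] at hαΔ
            exact hαΔ.resolve_right hαl
          refine ⟨rrefl α * w * (rrefl α)⁻¹, weylOf_conj Δl _ ?_ w hw, ?_⟩
          · intro β hβ
            rw [hlmem] at hβ ⊢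
            exact ⟨hrefl α hαΔ β hβ.1, by rw [LinearIsometryEquiv.norm_map]; exact hβ.2⟩
          · have hinv : (rrefl α)⁻¹ γ = rrefl α γ := by
              change (rrefl α).symm γ = _
              rw [LinearIsometryEquiv.symm_apply_eq, rrefl_invol]
            have he : (rrefl α * w * (rrefl α)⁻¹) γ = rrefl α (w (rrefl α γ)) := by
              rw [← hinv]; rfl
            rw [he]
            refine ⟨hrefl α hαΔ _ hwΔ, ?_⟩
            obtain ⟨m, hm⟩ := hcrys α hαΔ _ hwΔ
            rw [rrefl_formula, hm, Int.cast_smul_eq_zsmul]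
            refine sub_mem hwZ (Submodule.smul_mem _ _ (Submodule.subset_span ?_))
            rw [hΦs]
            exact ⟨hαΦ, hαs⟩
      · have hnp : -rrefl α γ ∈ Δp := by
          by_contra h
          exact hp ((hpm _ hrΔ).2 h)
        have hsub : c.support ⊆ {α} := by
          intro β hβ
          rw [Finset.mem_singleton]
          by_contra hne
          classical
          obtain ⟨f, hf⟩ := exists_functional Φ hΦind (fun a => if a = β then 1 else 0)
          have h1 := hnn f (fun a ha => by rw [hf a ha]; split_ifs <;> norm_num) _ hnp
          have h2 : f γ = c β := by
            rw [hγc, hval, Finset.sum_eq_single β]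
            · rw [hf β (hc hβ)]; simp
            · intro a ha hab
              rw [hf a (hc ha)]; simp [hab]
            · intro h; exact absurd hβ h
          have h3 : f α = 0 := by
            rw [hf α hαΦ]; simp [Ne.symm hne]
          rw [hr, map_neg, map_sub, map_smul, h2, h3] at h1
          have h4 : (0 : ℝ) < c β := by
            exact_mod_cast Nat.pos_of_ne_zero (Finsupp.mem_support_iff.1 hβ)
          simp at h1
          have h5 : (c β : ℝ) = 0 := by exact_mod_cast h1
          linarith
        have hγα : γ = (c α : ℝ) • α := by
          rw [hγc, Finsupp.sum, Finset.sum_subset hsub, Finset.sum_singleton]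
          · intro x _ hx
            rw [Finsupp.notMem_support_iff.1 hx]; simp
        have hγeq : γ = α := by
          rcases hred α hαΔ (c α) (hγα ▸ hγΔ) with h | h
          · rw [hγα, h, one_smul]
          · have : (0 : ℝ) ≤ c α := Nat.cast_nonneg _
            linarith
        refine ⟨1, one_mem _, hγΔ, Submodule.subset_span ?_⟩
        rw [hΦs]
        exact ⟨by rw [← hγeq] at hαΦ; exact hαΦ, hγs⟩
  have key2 : ∀ γ ∈ Δs, ∃ w ∈ weylOf Δl, w γ ∈ Δ ∧ w γ ∈ Submodule.span ℤ Φs := by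
    intro γ hγ
    have hγΔ := ((hsmem γ).1 hγ).1
    by_cases hp : γ ∈ Δp
    · obtain ⟨n, hn⟩ := exists_nat_gt (ht γ)
      exact key n γ hp hγ hn
    · have hnp : -γ ∈ Δp := by
        by_contra h
        exact hp ((hpm _ hγΔ).2 h)
      obtain ⟨n, hn⟩ := exists_nat_gt (ht (-γ))
      obtain ⟨w, hw, h1, h2⟩ := key n (-γ) hnp
        ((hsmem _).2 ⟨hneg _ hγΔ, by rw [norm_neg]; exact ((hsmem γ).1 hγ).2⟩) hn
      refine ⟨w, hw, ?_⟩
      rw [map_neg] at h1 h2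
      exact ⟨by simpa using hneg _ h1, by simpa using h2⟩
  intro γ hγ
  obtain ⟨w, hw, h1, h2⟩ := key2 γ hγ
  obtain ⟨c, hc, hce⟩ := Submodule.mem_span_set.1 h2
  exact ⟨w, hw, h1, c, hc, hce.symm⟩
end
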